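/- Let σ > 3/2 be fixed. Then for every ε > 0 and all T ≥ 2, ∫_1^T |K(σ+it)|² dt ≪_{σ,ε} T^{1+ε}. -/

import Mathlib

open MeasureTheory Complex

lemma aux_bessel (g : ℝ → ℝ) (h1 : Integrable g) (h2 : Integrable (fun u => g u ^ 2))
    (T : ℝ) (hT : 1 ≤ T) :
    ∫ t in (1:ℝ)..T, ‖∫ u : ℝ, (g u : ℂ) * cexp (-(I * t * u))‖ ^ 2 ≤ 100 * ∫ u, g u ^ 2 ∧
    Continuous (fun t : ℝ => ∫ u : ℝ, (g u : ℂ) * cexp (-(I * t * u))) := by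
  set G : ℝ → ℂ := fun t => ∫ u : ℝ, (g u : ℂ) * cexp (-(I * t * u)) with hG
  set d : ℝ := 1 / T ^ 2 with hd
  have hdpos : 0 < d := by positivity
  have h1c : Integrable (fun u => (g u : ℂ)) := h1.ofReal
  have hnorm : ∀ t u : ℝ, ‖cexp (-(I * t * u))‖ = 1 := by
    intro t u
    rw [Complex.norm_exp]; simp
  -- pointwise square
  have hsq : ∀ t : ℝ, ((‖G t‖ ^ 2 : ℝ) : ℂ) =
      ∫ p : ℝ × ℝ, (g p.1 : ℂ) * (g p.2 : ℂ) * cexp (-(I * t * (p.1 - p.2))) := by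
    intro t
    have hc : (starRingEnd ℂ) (G t) = ∫ u : ℝ, (g u : ℂ) * cexp (I * t * u) := by
      rw [hG, ← integral_conj]
      congr 1; ext u
      rw [map_mul, conj_ofReal, ← Complex.exp_conj]
      simp
    rw [ofReal_pow, ← Complex.mul_conj', hc, hG]
    simp only
    rw [← integral_prod_mul]
    congr 1; ext p
    have : cexp (-(I * t * (p.1 - p.2))) = cexp (-(I * t * p.1)) * cexp (I * t * p.2) := by
      rw [← Complex.exp_add]; congr 1; ring
    rw [this]; ring
  have hgauss : Integrable (fun t : ℝ => Real.exp (-d * t ^ 2)) := integrable_exp_neg_mul_sq hdpos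
  have hgg : Integrable (fun p : ℝ × ℝ => (g p.1 : ℂ) * (g p.2 : ℂ)) := h1c.mul_prod h1c
  have hF : Integrable (fun q : ℝ × (ℝ × ℝ) => (Real.exp (-d * q.1 ^ 2) : ℂ) *
      ((g q.2.1 : ℂ) * (g q.2.2 : ℂ) * cexp (-(I * q.1 * (q.2.1 - q.2.2))))) := by
    have := (hgauss.ofReal (𝕜 := ℂ)).mul_prod hgg
    have h3 := this.mul_bdd (c := 1) (g := fun q : ℝ × (ℝ × ℝ) => cexp (-(I * q.1 * (q.2.1 - q.2.2))))
      (by apply Continuous.aestronglyMeasurable; fun_prop)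
      (by
        refine Filter.Eventually.of_forall fun q => ?_
        have := hnorm q.1 (q.2.1 - q.2.2)
        push_cast at this
        rw [this])
    refine h3.congr (Filter.Eventually.of_forall fun q => ?_)
    simp [mul_assoc]
  have hswap := integral_integral_swap (f := fun (t : ℝ) (p : ℝ × ℝ) => (Real.exp (-d * t ^ 2) : ℂ) *
      ((g p.1 : ℂ) * (g p.2 : ℂ) * cexp (-(I * t * (p.1 - p.2))))) hF
  -- kernel
  set k : ℝ → ℝ := fun x => Real.sqrt (Real.pi / d) * Real.exp (-(1 / (4 * d)) * x ^ 2) with hk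
  have hkpos : ∀ x, 0 ≤ k x := fun x => by positivity
  have hkint : Integrable k := (integrable_exp_neg_mul_sq (by positivity)).const_mul _
  have hkval : ∫ x, k x = 2 * Real.pi := by
    rw [hk, integral_const_mul, integral_gaussian, ← Real.sqrt_mul (by positivity)]
    rw [show Real.pi / d * (Real.pi / (1 / (4 * d))) = (2 * Real.pi) ^ 2 by field_simp; ring]
    exact Real.sqrt_sq (by positivity)
  have hinner : ∀ p : ℝ × ℝ, ∫ t : ℝ, (Real.exp (-d * t ^ 2) : ℂ) *
      ((g p.1 : ℂ) * (g p.2 : ℂ) * cexp (-(I * t * (p.1 - p.2)))) =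
      ((g p.1 * g p.2 * k (p.1 - p.2) : ℝ) : ℂ) := by
    intro p
    have h4 := fourierIntegral_gaussian (b := (d : ℂ)) (by simpa using hdpos) (-((p.1 : ℂ) - p.2))
    have h5 : ∫ t : ℝ, (Real.exp (-d * t ^ 2) : ℂ) *
      ((g p.1 : ℂ) * (g p.2 : ℂ) * cexp (-(I * t * (p.1 - p.2)))) =
      (g p.1 : ℂ) * (g p.2 : ℂ) * ∫ t : ℝ, cexp (I * (-((p.1 : ℂ) - p.2)) * t) * cexp (-(d:ℂ) * t ^ 2) := by
      rw [← integral_const_mul]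
      congr 1; ext t
      push_cast
      rw [show I * (-((p.1 : ℂ) - p.2)) * t = -(I * t * (p.1 - p.2)) by ring]
      ring
    rw [h5, h4, hk]
    have h6 : ((Real.pi : ℂ) / d) ^ (1 / 2 : ℂ) = (Real.sqrt (Real.pi / d) : ℂ) := by
      rw [Real.sqrt_eq_rpow, Complex.ofReal_cpow (by positivity)]
      push_cast; rfl
    rw [h6]
    push_cast
    congr 2
    congr 1
    field_simp
  have hA : ((∫ t : ℝ, Real.exp (-d * t ^ 2) * ‖G t‖ ^ 2 : ℝ) : ℂ) =
      ((∫ p : ℝ × ℝ, g p.1 * g p.2 * k (p.1 - p.2) : ℝ) : ℂ) := by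
    rw [← integral_complex_ofReal, ← integral_complex_ofReal]
    simp_rw [← hinner]
    rw [← hswap]
    congr 1; ext t
    rw [integral_const_mul, ← hsq]
    push_cast; rfl
  have hA' := Complex.ofReal_injective hA
  have hI1 : Integrable (fun p : ℝ × ℝ => g p.2 ^ 2 * k (p.1 - p.2)) := by
    have := Integrable.convolution_integrand (ContinuousLinearMap.mul ℝ ℝ) h2 hkint
    exact this
  have hksym : ∀ x, k (-x) = k x := fun x => by simp [hk]
  have hI2 : Integrable (fun p : ℝ × ℝ => g p.1 ^ 2 * k (p.1 - p.2)) := by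
    refine hI1.swap.congr (Filter.Eventually.of_forall fun p => ?_)
    simp only [Function.comp, Prod.fst_swap, Prod.snd_swap]
    rw [← hksym, neg_sub]
  have hV2 : ∫ p : ℝ × ℝ, g p.1 ^ 2 * k (p.1 - p.2) = (∫ u, g u ^ 2) * (2 * Real.pi) := by
    rw [Measure.volume_eq_prod, integral_prod _ hI2, ← integral_mul_const]
    congr 1; ext x
    simp only
    rw [integral_const_mul, integral_sub_left_eq_self k volume x, hkval]
  have hV1 : ∫ p : ℝ × ℝ, g p.2 ^ 2 * k (p.1 - p.2) = (∫ u, g u ^ 2) * (2 * Real.pi) := by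
    rw [← hV2, Measure.volume_eq_prod, ← integral_prod_swap (μ := volume) (ν := volume)]
    congr 1; ext p
    simp only [Prod.fst_swap, Prod.snd_swap]
    rw [← hksym, neg_sub]
  have hB : ∫ p : ℝ × ℝ, g p.1 * g p.2 * k (p.1 - p.2) ≤ (∫ u, g u ^ 2) * (2 * Real.pi) := by
    have h7 : (∫ u, g u ^ 2) * (2 * Real.pi) =
        ∫ p : ℝ × ℝ, ((1/2) * (g p.1 ^ 2 * k (p.1 - p.2)) + (1/2) * (g p.2 ^ 2 * k (p.1 - p.2))) := by
      rw [integral_add (hI2.const_mul _) (hI1.const_mul _), integral_const_mul, integral_const_mul,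
        hV1, hV2]; ring
    rw [h7]
    have h8 : Integrable (fun p : ℝ × ℝ => g p.1 * g p.2 * k (p.1 - p.2)) := by
      have := hF.integral_prod_right
      simp_rw [hinner] at this
      exact this.re
    refine integral_mono h8 ((hI2.const_mul _).add (hI1.const_mul _)) fun p => ?_
    have := mul_nonneg (hkpos (p.1 - p.2)) (sq_nonneg (g p.1 - g p.2))
    simp only
    nlinarith
  -- final
  have hint : Integrable (fun t : ℝ => Real.exp (-d * t ^ 2) * ‖G t‖ ^ 2) := by
    have := hF.integral_prod_left
    refine this.re.congr (Filter.Eventually.of_forall fun t => ?_)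
    simp only
    rw [integral_const_mul, ← hsq, ← ofReal_mul]
    simp only [RCLike.re_to_complex, ofReal_re]
  have hGc : Continuous G := by
    refine continuous_of_dominated (bound := fun u => ‖g u‖) ?_ ?_ h1.norm ?_
    · intro t
      exact h1c.aestronglyMeasurable.mul (by apply Continuous.aestronglyMeasurable; fun_prop)
    · intro t
      refine Filter.Eventually.of_forall fun u => ?_
      rw [norm_mul, hnorm]; simp
    · refine Filter.Eventually.of_forall fun u => ?_
      fun_prop
  have hC : ∫ t in (1:ℝ)..T, ‖G t‖ ^ 2 ≤ Real.exp 1 * ∫ t : ℝ, Real.exp (-d * t ^ 2) * ‖G t‖ ^ 2 := by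
    rw [← integral_const_mul, intervalIntegral.integral_of_le hT]
    have hint' := hint.const_mul (Real.exp 1)
    refine le_trans ?_ (setIntegral_le_integral (s := Set.Ioc 1 T) hint' ?_)
    · refine setIntegral_mono_on ?_ hint'.integrableOn measurableSet_Ioc ?_
      · exact (by fun_prop : Continuous fun t => ‖G t‖ ^ 2).integrableOn_Ioc
      · intro t ht
        rw [← mul_assoc, ← Real.exp_add]
        have : d * t ^ 2 ≤ 1 := by
          rw [hd, div_mul_eq_mul_div, one_mul, div_le_one (by positivity)]
          have := ht.1; have := ht.2
          gcongr
        have h9 : 1 ≤ Real.exp (1 + -d * t ^ 2) := Real.one_le_exp (by linarith)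
        nlinarith [sq_nonneg ‖G t‖]
    · refine Filter.Eventually.of_forall fun t => ?_
      simp only [Pi.zero_apply]; positivity
  refine ⟨hC.trans ?_, hGc⟩
  rw [hA']
  have hS : 0 ≤ ∫ u, g u ^ 2 := integral_nonneg fun u => sq_nonneg _
  have he : Real.exp 1 < 3 := Real.exp_one_lt_three
  have hpi := Real.pi_lt_four
  have := Real.pi_pos
  have h10 : Real.exp 1 * (2 * Real.pi) ≤ 100 := by nlinarith [Real.exp_pos 1]
  calc _ ≤ Real.exp 1 * ((∫ u, g u ^ 2) * (2 * Real.pi)) := by gcongr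
    _ = (Real.exp 1 * (2 * Real.pi)) * (∫ u, g u ^ 2) := by ring
    _ ≤ _ := by gcongr

lemma aux_exp_int (a c : ℝ) (ha : a < 0) :
    Integrable ((Set.Ioi (0:ℝ)).indicator (fun u => c * Real.exp (a * u))) :=
  (integrable_indicator_iff measurableSet_Ioi).2 ((integrableOn_exp_mul_Ioi ha 0).const_mul c)

lemma aux_N (N : ℝ → ℝ) (b γ B : ℝ) (hN : Monotone N) (hN0 : ∀ u, 0 ≤ N u)
    (hb0 : 0 < b) (hNB : ∀ u, 0 ≤ u → N u ≤ B * Real.exp (γ * u)) (hb : γ < b) :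
    ∃ C, 0 ≤ C ∧ ∀ h, 0 < h → h ≤ 1 →
      Integrable ((Set.Ioi (0:ℝ)).indicator (fun u => Real.exp (-b * u) * (N (u + h) - N u))) ∧
      ∫ u, ((Set.Ioi (0:ℝ)).indicator (fun u => Real.exp (-b * u) * (N (u + h) - N u))) u ≤ C * h := by
  set n : ℝ → ℝ := (Set.Ioi (0:ℝ)).indicator (fun u => Real.exp (-b * u) * N u) with hn
  have hNm : Measurable N := hN.measurable
  have hn0 : ∀ u, 0 ≤ n u := fun u => Set.indicator_nonneg (fun u _ => mul_nonneg (Real.exp_pos _).le (hN0 u)) u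
  have hni : Integrable n := by
    refine (aux_exp_int (γ - b) B (by linarith)).mono' ?_ ?_
    · exact (Measurable.indicator (by fun_prop) measurableSet_Ioi).aestronglyMeasurable
    · refine Filter.Eventually.of_forall fun u => ?_
      rw [Real.norm_of_nonneg (hn0 u)]
      refine Set.indicator_le_indicator' fun hu => ?_
      have := hNB u (le_of_lt hu)
      calc _ ≤ Real.exp (-b * u) * (B * Real.exp (γ * u)) := by gcongr
        _ = B * (Real.exp (-b * u) * Real.exp (γ * u)) := by ring
        _ = _ := by rw [← Real.exp_add]; ring_nf
  have hI0 : 0 ≤ ∫ u, n u := integral_nonneg hn0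
  refine ⟨b * Real.exp b * ∫ u, n u, by positivity, fun h hh hh1 => ?_⟩
  have hle : ∀ u, (Set.Ioi (0:ℝ)).indicator (fun u => Real.exp (-b * u) * (N (u + h) - N u)) u
      ≤ Real.exp (b * h) * n (u + h) - n u := by
    intro u
    by_cases hu : u ∈ Set.Ioi (0:ℝ)
    · have hu' : 0 < u := hu
      have hu2 : u + h ∈ Set.Ioi (0:ℝ) := by simp; linarith
      rw [hn, Set.indicator_of_mem hu, Set.indicator_of_mem hu, Set.indicator_of_mem hu2]
      rw [← mul_assoc, ← Real.exp_add]
      have : b * h + -b * (u + h) = -b * u := by ring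
      rw [this]; apply le_of_eq; ring
    · have : n u = 0 := by rw [hn, Set.indicator_of_notMem hu]
      rw [Set.indicator_of_notMem hu, this]
      have := hn0 (u + h); simp; positivity
  have hri : Integrable (fun u => Real.exp (b * h) * n (u + h) - n u) :=
    ((hni.comp_add_right h).const_mul _).sub hni
  have hli : Integrable ((Set.Ioi (0:ℝ)).indicator (fun u => Real.exp (-b * u) * (N (u + h) - N u))) := by
    refine hri.mono' ?_ ?_
    · exact (Measurable.indicator (by fun_prop) measurableSet_Ioi).aestronglyMeasurable
    · refine Filter.Eventually.of_forall fun u => ?_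
      rw [Real.norm_of_nonneg]
      · exact hle u
      · exact Set.indicator_nonneg (fun u _ => mul_nonneg (Real.exp_pos _).le
          (sub_nonneg.2 (hN (by linarith)))) u
  refine ⟨hli, (integral_mono hli hri hle).trans ?_⟩
  rw [integral_sub ((hni.comp_add_right h).const_mul _) hni, integral_const_mul,
    integral_add_right_eq_self n h]
  have h1 : Real.exp (b * h) - 1 ≤ b * Real.exp b * h := by
    have h2 := Real.add_one_le_exp (-(b * h))
    have h3 : Real.exp (b * h) * Real.exp (-(b * h)) = 1 := by rw [← Real.exp_add]; simp
    have h4 : Real.exp (b * h) ≤ Real.exp b := Real.exp_le_exp.2 (by nlinarith)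
    have h5 : Real.exp (b * h) - 1 ≤ Real.exp (b * h) * (b * h) := by nlinarith [Real.exp_pos (b * h)]
    have h6 : Real.exp (b * h) * (b * h) ≤ Real.exp b * (b * h) := by gcongr
    linarith
  nlinarith

lemma aux_core (e N : ℝ → ℝ) (σ β γ A B D : ℝ) (he : Continuous e) (hN : Monotone N)
    (hN0 : ∀ u, 0 ≤ N u) (hβ : 0 ≤ β) (hγ : 0 ≤ γ) (hA : 0 ≤ A) (hD : 0 ≤ D) (hσ : 0 ≤ σ)
    (heA : ∀ u, 0 ≤ u → |e u| ≤ A * Real.exp (β * u))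
    (hNB : ∀ u, 0 ≤ u → N u ≤ B * Real.exp (γ * u))
    (hd : ∀ h u, 0 < h → h ≤ 1 → 0 ≤ u →
      |e (u + h) - e u| ≤ N (u + h) - N u + h * (D * Real.exp (γ * u)))
    (h1 : 3 * β + γ < 2 * σ) :
    ∃ C, 0 ≤ C ∧ ∀ h, 0 < h → h ≤ 1 →
      Integrable (fun u => (((Set.Ioi (0:ℝ)).indicator (fun u => e u ^ 2) (u + h)
        - (Set.Ioi (0:ℝ)).indicator (fun u => e u ^ 2) u) * Real.exp (-σ * u)) ^ 2) ∧
      ∫ u, (((Set.Ioi (0:ℝ)).indicator (fun u => e u ^ 2) (u + h)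
        - (Set.Ioi (0:ℝ)).indicator (fun u => e u ^ 2) u) * Real.exp (-σ * u)) ^ 2 ≤ C * h := by
  set b := 2 * σ - 3 * β with hb
  obtain ⟨C1, hC1, hN1⟩ := aux_N N b γ B hN hN0 (by linarith) hNB (by linarith)
  set A' := A * Real.exp β with hA'
  have hA'0 : 0 ≤ A' := by positivity
  set c := 8 * A' ^ 3 with hc
  have hc0 : 0 ≤ c := by positivity
  set m2 : ℝ → ℝ := (Set.Ioi (0:ℝ)).indicator (fun u => c * D * Real.exp ((γ - b) * u)) with hm2
  have hm2i : Integrable m2 := aux_exp_int _ _ (by linarith)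
  have hm20 : ∀ u, 0 ≤ m2 u := fun u => Set.indicator_nonneg (fun u _ => by positivity) u
  have hI2 : 0 ≤ ∫ u, m2 u := integral_nonneg hm20
  set c3 := A' ^ 4 * Real.exp (2 * σ) with hc3
  refine ⟨c3 + c * C1 + ∫ u, m2 u, by positivity, fun h hh hh1 => ?_⟩
  obtain ⟨hn1, hn2⟩ := hN1 h hh hh1
  set m1 : ℝ → ℝ := (Set.Ioi (0:ℝ)).indicator (fun u => Real.exp (-b * u) * (N (u + h) - N u)) with hm1
  have hm10 : ∀ u, 0 ≤ m1 u := fun u => Set.indicator_nonneg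
    (fun u _ => mul_nonneg (Real.exp_pos _).le (sub_nonneg.2 (hN (by linarith)))) u
  set m3 : ℝ → ℝ := (Set.Ioc (-h) 0).indicator (fun _ => c3) with hm3
  have hm3i : Integrable m3 := by
    rw [hm3, integrable_indicator_iff measurableSet_Ioc]
    exact integrableOn_const (by simp)
  have hm3v : ∫ u, m3 u = c3 * h := by
    rw [hm3, integral_indicator measurableSet_Ioc, setIntegral_const]
    simp [hh.le, mul_comm]
  have hm30 : ∀ u, 0 ≤ m3 u := fun u => Set.indicator_nonneg (fun u _ => by positivity) u
  set ψ : ℝ → ℝ := (Set.Ioi (0:ℝ)).indicator (fun u => e u ^ 2) with hψ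
  have hψm : Measurable ψ := Measurable.indicator (by fun_prop) measurableSet_Ioi
  have heA' : ∀ u v, 0 ≤ u → u ≤ v → v ≤ u + 1 → |e v| ≤ A' * Real.exp (β * u) := by
    intro u v hu huv hv
    refine (heA v (by linarith)).trans ?_
    rw [hA', mul_assoc, ← Real.exp_add]
    gcongr
    nlinarith
  have hle : ∀ u, ((ψ (u + h) - ψ u) * Real.exp (-σ * u)) ^ 2 ≤ m3 u + c * m1 u + h * m2 u := by
    intro u
    by_cases hu : 0 < u
    · have e1 : ψ (u + h) = e (u + h) ^ 2 := Set.indicator_of_mem (by simp; linarith) _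
      have e2 : ψ u = e u ^ 2 := Set.indicator_of_mem hu _
      have e3 : m1 u = Real.exp (-b * u) * (N (u + h) - N u) := Set.indicator_of_mem hu _
      have e4 : m2 u = c * D * Real.exp ((γ - b) * u) := Set.indicator_of_mem hu _
      rw [e1, e2, e3, e4]
      have f1 := heA' u u hu.le le_rfl (by linarith)
      have f2 := heA' u (u + h) hu.le (by linarith) (by linarith)
      have f3 := hd h u hh hh1 hu.le
      set X := A' * Real.exp (β * u) with hX
      set Δ := |e (u + h) - e u| with hΔ
      have hX0 : 0 ≤ X := by positivity
      have hΔ0 : 0 ≤ Δ := abs_nonneg _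
      have g1 : Δ ≤ 2 * X := (abs_sub _ _).trans (by linarith)
      have g2 : |e (u + h) + e u| ≤ 2 * X := (abs_add_le _ _).trans (by linarith)
      have g3 : (e (u + h) ^ 2 - e u ^ 2) ^ 2 = Δ * Δ * |e (u + h) + e u| ^ 2 := by
        rw [sq_abs, hΔ, abs_mul_abs_self]; ring
      have g4 : (e (u + h) ^ 2 - e u ^ 2) ^ 2 ≤ (2 * X) * (N (u + h) - N u + h * (D * Real.exp (γ * u))) * (2 * X) ^ 2 := by
        rw [g3]
        have := hΔ0.trans f3
        gcongr
      have g5 : X ^ 3 * Real.exp (-σ * u) ^ 2 = A' ^ 3 * Real.exp (-b * u) := by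
        rw [hX, mul_pow, mul_assoc, ← Real.exp_nat_mul, ← Real.exp_nat_mul, ← Real.exp_add, hb]
        congr 2; push_cast; ring
      have g6 : Real.exp ((γ - b) * u) = Real.exp (γ * u) * Real.exp (-b * u) := by
        rw [← Real.exp_add]; ring_nf
      rw [mul_pow]
      calc _ ≤ (2 * X) * (N (u + h) - N u + h * (D * Real.exp (γ * u))) * (2 * X) ^ 2 * Real.exp (-σ * u) ^ 2 := by gcongr
        _ = 8 * (X ^ 3 * Real.exp (-σ * u) ^ 2) * (N (u + h) - N u + h * (D * Real.exp (γ * u))) := by ring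
        _ = 0 + c * (Real.exp (-b * u) * (N (u + h) - N u)) + h * (c * D * Real.exp ((γ - b) * u)) := by
          rw [g5, g6, hc]; ring
        _ ≤ _ := by
          have := hm30 u
          gcongr
    · have e2 : ψ u = 0 := Set.indicator_of_notMem hu _
      have r0 : 0 ≤ c * m1 u + h * m2 u := by
        have := hm10 u; have := hm20 u; positivity
      by_cases hu2 : -h < u
      · have e1 : ψ (u + h) = e (u + h) ^ 2 := Set.indicator_of_mem (by simp; linarith) _
        have e3 : m3 u = c3 := Set.indicator_of_mem (by simp; constructor <;> linarith) _
        rw [e1, e2, e3, sub_zero]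
        have f2 := heA' 0 (u + h) le_rfl (by linarith) (by linarith)
        simp only [mul_zero, Real.exp_zero, mul_one] at f2
        have f4 : (e (u + h) ^ 2) ^ 2 ≤ A' ^ 4 := by
          calc (e (u + h) ^ 2) ^ 2 = |e (u + h)| ^ 4 := by rw [← sq_abs (e (u + h))]; ring
            _ ≤ _ := by gcongr
        have f5 : Real.exp (-σ * u) ^ 2 ≤ Real.exp (2 * σ) := by
          rw [← Real.exp_nat_mul]
          apply Real.exp_le_exp.2
          push_cast; nlinarith
        rw [mul_pow]
        calc _ ≤ c3 := by rw [hc3]; gcongr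
          _ ≤ _ := by linarith
      · have e1 : ψ (u + h) = 0 := Set.indicator_of_notMem (by simp; linarith) _
        rw [e1, e2]
        have := hm30 u
        simp; linarith
  have hmi : Integrable (fun u => m3 u + c * m1 u + h * m2 u) :=
    (hm3i.add (hn1.const_mul c)).add (hm2i.const_mul h)
  have hgi : Integrable (fun u => ((ψ (u + h) - ψ u) * Real.exp (-σ * u)) ^ 2) := by
    refine hmi.mono' ?_ ?_
    · exact Measurable.aestronglyMeasurable (by fun_prop)
    · refine Filter.Eventually.of_forall fun u => ?_
      rw [Real.norm_of_nonneg (sq_nonneg _)]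
      exact hle u
  refine ⟨hgi, (integral_mono hgi hmi hle).trans ?_⟩
  have hadd : Integrable (fun u => m3 u + c * m1 u) := hm3i.add (hn1.const_mul c)
  rw [integral_add hadd (hm2i.const_mul h),
    integral_add hm3i (hn1.const_mul c), integral_const_mul, integral_const_mul, hm3v]
  have : c * ∫ u, m1 u ≤ c * (C1 * h) := by gcongr
  linarith

lemma aux_bdd (f : ℝ → ℝ) (hf : Continuous f) (Y : ℝ) : ∃ C, 0 ≤ C ∧ ∀ u, 0 ≤ u → u ≤ Y → |f u| ≤ C := by
  obtain ⟨C, hC⟩ := (isCompact_Icc (a := (0:ℝ)) (b := Y)).exists_bound_of_continuousOn hf.continuousOn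
  exact ⟨max C 0, le_max_right _ _, fun u h0 h1 => (hC u ⟨h0, h1⟩).trans (le_max_left _ _)⟩

lemma aux_poly (p : Polynomial ℝ) (δ : ℝ) (hδ : 0 < δ) :
    ∃ C, 0 ≤ C ∧ ∀ u, 0 ≤ u → |p.eval u| ≤ C * Real.exp (δ * u) := by
  have h := (p.comp (Polynomial.C (1/δ) * Polynomial.X)).tendsto_div_exp_atTop
  have h2 := h.abs.eventually_le_const (u := (1:ℝ)) (by rw [abs_zero]; exact one_pos)
  obtain ⟨Y, hY⟩ := Filter.eventually_atTop.1 h2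
  obtain ⟨C, hC, hCb⟩ := aux_bdd (fun u => p.eval u) p.continuous (Y / δ)
  refine ⟨C + 1, by positivity, fun u hu => ?_⟩
  by_cases hc : u ≤ Y / δ
  · have := hCb u hu hc
    have h3 : 1 ≤ Real.exp (δ * u) := Real.one_le_exp (by positivity)
    nlinarith
  · have h4 := hY (δ * u) (by
      have := (div_lt_iff₀ hδ).1 (not_le.1 hc); linarith)
    rw [abs_div, abs_of_pos (Real.exp_pos _), div_le_one (Real.exp_pos _)] at h4
    simp only [Polynomial.eval_comp, Polynomial.eval_mul, Polynomial.eval_C, Polynomial.eval_X] at h4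
    rw [show 1 / δ * (δ * u) = u by field_simp] at h4
    have := Real.exp_pos (δ * u)
    nlinarith

lemma aux_zeta : Continuous (fun t : ℝ => ‖riemannZeta (1/2 + Complex.I * t)‖ ^ 4) := by
  rw [continuous_iff_continuousAt]
  intro t
  have h : ContinuousAt riemannZeta (1/2 + Complex.I * t) := by
    refine (differentiableAt_riemannZeta ?_).continuousAt
    intro h
    have := congrArg Complex.re h
    norm_num at this
  have h2 : ContinuousAt (fun t : ℝ => (1/2 + Complex.I * t : ℂ)) t := by fun_prop
  exact ((ContinuousAt.comp (f := fun t : ℝ => (1/2 + Complex.I * t : ℂ)) h h2).norm.pow 4)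

lemma aux_poly_diff (P : Polynomial ℝ) (δ : ℝ) (hδ : 0 < δ) :
    ∃ D, 0 ≤ D ∧ ∀ h u, 0 < h → h ≤ 1 → 0 ≤ u →
      |Real.exp (u + h) * P.eval (u + h) - Real.exp u * P.eval u| ≤ h * (D * Real.exp ((1 + δ) * u)) := by
  obtain ⟨C, hC, hCb⟩ := aux_poly (P + P.derivative) δ hδ
  refine ⟨C * Real.exp (1 + δ), by positivity, fun h u hh hh1 hu => ?_⟩
  have hder : ∀ x, HasDerivAt (fun u => Real.exp u * P.eval u)
      (Real.exp x * P.eval x + Real.exp x * P.derivative.eval x) x :=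
    fun x => (Real.hasDerivAt_exp x).mul (P.hasDerivAt x)
  have := Convex.norm_image_sub_le_of_norm_deriv_le (f := fun u => Real.exp u * P.eval u)
    (s := Set.Icc u (u + h)) (x := u) (y := u + h) (C := C * Real.exp (1 + δ) * Real.exp ((1 + δ) * u))
    (fun x _ => (hder x).differentiableAt) (fun x hx => ?_) (convex_Icc _ _)
    ⟨le_rfl, by linarith⟩ ⟨by linarith, le_rfl⟩
  · simp only [Real.norm_eq_abs] at this
    rw [show u + h - u = h by ring, abs_of_pos hh] at this
    linarith
  · rw [(hder x).deriv, ← mul_add, ← Polynomial.eval_add, norm_mul, Real.norm_eq_abs, Real.norm_eq_abs, Real.abs_exp]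
    have h1 := hCb x (hu.trans hx.1)
    calc _ ≤ Real.exp x * (C * Real.exp (δ * x)) := by gcongr
      _ = C * Real.exp ((1 + δ) * x) := by
        rw [show (1 + δ) * x = x + δ * x by ring, Real.exp_add]; ring
      _ ≤ C * Real.exp ((1 + δ) + (1 + δ) * u) := by
        gcongr
        have := hx.2
        nlinarith
      _ = _ := by rw [Real.exp_add]; ring

lemma aux_transfer (e : ℝ → ℝ) (σ β A : ℝ) (he : Continuous e)
    (heA : ∀ u, 0 ≤ u → |e u| ≤ A * Real.exp (β * u)) (hb : 2 * β < σ) (h : ℝ) :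
    Integrable (fun u => (((Set.Ioi (0:ℝ)).indicator (fun u => e u ^ 2) (u + h)
        - (Set.Ioi (0:ℝ)).indicator (fun u => e u ^ 2) u) * Real.exp (-σ * u))) ∧
    ∀ t : ℝ, ∫ u : ℝ, ((((Set.Ioi (0:ℝ)).indicator (fun u => e u ^ 2) (u + h)
        - (Set.Ioi (0:ℝ)).indicator (fun u => e u ^ 2) u) * Real.exp (-σ * u) : ℝ) : ℂ) *
          cexp (-(I * t * u)) = (cexp ((σ + I * t) * h) - 1) *
          ∫ u in Set.Ioi (0:ℝ), ((e u ^ 2 : ℝ) : ℂ) * cexp (-(σ + I * t) * u) := by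
  set ψ : ℝ → ℝ := (Set.Ioi (0:ℝ)).indicator (fun u => e u ^ 2) with hψ
  have hψm : Measurable ψ := Measurable.indicator (by fun_prop) measurableSet_Ioi
  have hφ : Integrable (fun u => ψ u * Real.exp (-σ * u)) := by
    have hm : Integrable ((Set.Ioi (0:ℝ)).indicator (fun u => A ^ 2 * Real.exp ((2 * β - σ) * u))) :=
      (integrable_indicator_iff measurableSet_Ioi).2
        ((integrableOn_exp_mul_Ioi (by linarith) 0).const_mul _)
    refine hm.mono' (Measurable.aestronglyMeasurable (by fun_prop)) ?_
    refine Filter.Eventually.of_forall fun u => ?_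
    by_cases hu : u ∈ Set.Ioi (0:ℝ)
    · rw [hψ, Set.indicator_of_mem hu, Set.indicator_of_mem hu, Real.norm_of_nonneg (by positivity)]
      have h1 := heA u (le_of_lt hu)
      calc e u ^ 2 * Real.exp (-σ * u) = |e u| ^ 2 * Real.exp (-σ * u) := by rw [sq_abs]
        _ ≤ (A * Real.exp (β * u)) ^ 2 * Real.exp (-σ * u) := by gcongr
        _ = A ^ 2 * (Real.exp (β * u) ^ 2 * Real.exp (-σ * u)) := by ring
        _ = _ := by
          rw [← Real.exp_nat_mul, ← Real.exp_add]; congr 2; push_cast; ring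
    · rw [hψ, Set.indicator_of_notMem hu, Set.indicator_of_notMem hu]; simp
  constructor
  · have := ((hφ.comp_add_right h).const_mul (Real.exp (σ * h))).sub hφ
    refine this.congr (Filter.Eventually.of_forall fun u => ?_)
    simp only [Pi.sub_apply]
    have : Real.exp (-σ * u) = Real.exp (σ * h) * Real.exp (-σ * (u + h)) := by
      rw [← Real.exp_add]; ring_nf
    rw [sub_mul]
    nth_rewrite 2 [this]
    ring
  · intro t
    set s : ℂ := σ + I * t with hs
    set Φ : ℝ → ℂ := fun u => (ψ u : ℂ) * cexp (-s * u) with hΦ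
    have hcs : ∀ u : ℝ, cexp (-s * u) = (Real.exp (-σ * u) : ℂ) * cexp (-(I * t * u)) := by
      intro u
      rw [ofReal_exp, ← Complex.exp_add, hs]; congr 1; push_cast; ring
    have hΦi : Integrable Φ := by
      have h3 := (hφ.ofReal (𝕜 := ℂ)).mul_bdd (c := 1) (g := fun u : ℝ => cexp (-(I * t * u)))
        (by apply Continuous.aestronglyMeasurable; fun_prop)
        (by
          refine Filter.Eventually.of_forall fun u => ?_
          rw [Complex.norm_exp]; simp)
      refine h3.congr (Filter.Eventually.of_forall fun u => ?_)
      simp only [hΦ, hcs]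
      push_cast
      simp [mul_assoc]
    have hR : ∫ u in Set.Ioi (0:ℝ), ((e u ^ 2 : ℝ) : ℂ) * cexp (-s * u) = ∫ u, Φ u := by
      rw [← integral_indicator measurableSet_Ioi]
      congr 1; ext u
      by_cases hu : u ∈ Set.Ioi (0:ℝ)
      · rw [hΦ, hψ, Set.indicator_of_mem hu]; simp only [Set.indicator_of_mem hu]
      · rw [hΦ, hψ, Set.indicator_of_notMem hu]; simp only [Set.indicator_of_notMem hu]; simp
    rw [hR, sub_mul, one_mul]
    nth_rewrite 1 [← integral_add_right_eq_self Φ h]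
    rw [← integral_const_mul, ← integral_sub ((hΦi.comp_add_right h).const_mul _) hΦi]
    congr 1; ext u
    simp only [hΦ]
    have h5 : cexp (-s * u) = cexp (s * h) * cexp (-s * ((u + h : ℝ) : ℂ)) := by
      rw [← Complex.exp_add]; congr 1; push_cast; ring
    have h6 : ((((ψ (u + h) - ψ u) * Real.exp (-σ * u) : ℝ) : ℂ)) * cexp (-(I * t * u)) =
      ((ψ (u + h) : ℂ) - ψ u) * cexp (-s * u) := by
      rw [hcs]; push_cast; ring
    rw [h6, sub_mul]
    nth_rewrite 1 [h5]
    ring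

lemma aux_cov (E : ℝ → ℝ) (s : ℂ) :
    ∫ x in Set.Ioi (1:ℝ), (((E x) ^ 2 : ℝ) : ℂ) * (x : ℂ) ^ (-s - 1) =
    ∫ u in Set.Ioi (0:ℝ), (((E (Real.exp u)) ^ 2 : ℝ) : ℂ) * cexp (-s * u) := by
  have := integral_comp_exp_Ioi (fun x : ℝ => (((E x) ^ 2 : ℝ) : ℂ) * (x : ℂ) ^ (-s - 1)) 0
  rw [Real.exp_zero] at this
  rw [← this]
  congr 1; ext u
  rw [Complex.real_smul, Complex.cpow_def_of_ne_zero (by exact_mod_cast (Real.exp_pos u).ne'),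
    ← Complex.ofReal_log (Real.exp_pos u).le, Real.log_exp]
  have : cexp (-s * u) = (Real.exp u : ℂ) * cexp (u * (-s - 1)) := by
    rw [ofReal_exp, ← Complex.exp_add]; congr 1; ring
  rw [this]; ring

theorem stmt_11
    (P4 : Polynomial ℝ) (hdeg : P4.degree = 4)
    (hlead : P4.leadingCoeff = 1 / (2 * Real.pi ^ 2))
    (E2 : ℝ → ℝ)
    (hE2 : ∀ T : ℝ, E2 T =
      (∫ t in (0:ℝ)..T, ‖riemannZeta (1/2 + Complex.I * t)‖ ^ 4)
        - T * P4.eval (Real.log T))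
    (hpt : ∀ ε > 0, ∃ C > 0, ∀ T : ℝ, 2 ≤ T → |E2 T| ≤ C * T ^ ((2:ℝ)/3 + ε))
    (hms : ∃ C > 0, ∃ A > 0, ∀ T : ℝ, 2 ≤ T →
      (∫ t in (1:ℝ)..T, (E2 t) ^ 2) ≤ A * T ^ 2 * Real.log T ^ C)
    (K : ℂ → ℂ)
    (hK : ∀ s : ℂ, 1 < s.re → K s =
      -(1/2 : ℂ) * ((E2 1 : ℝ) : ℂ) ^ 2 -
        (1/2 : ℂ) * s * ∫ x in Set.Ioi (1:ℝ), (((E2 x) ^ 2 : ℝ) : ℂ) * (x : ℂ) ^ (-s - 1))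
    (σ : ℝ) (hσ : 3/2 < σ) (ε : ℝ) (hε : 0 < ε) :
    ∃ C > 0, ∀ T : ℝ, 2 ≤ T →
      (∫ t in (1:ℝ)..T, ‖K (σ + Complex.I * t)‖ ^ 2) ≤ C * T ^ (1 + ε) := by
  obtain ⟨δ, hδ, hδ1, hδ2⟩ : ∃ δ : ℝ, 0 < δ ∧ δ < 1/12 ∧ 4 * δ < 2 * σ - 3 := by
    refine ⟨min (1/13) ((2 * σ - 3) / 8), lt_min (by norm_num) (by linarith), ?_, ?_⟩
    · exact (min_le_left _ _).trans_lt (by norm_num)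
    · have := min_le_right (1/13) ((2 * σ - 3) / 8); linarith
  set z : ℝ → ℝ := fun t => ‖riemannZeta (1/2 + Complex.I * t)‖ ^ 4 with hz
  have hzc : Continuous z := aux_zeta
  have hz0 : ∀ t, 0 ≤ z t := fun t => by positivity
  set N : ℝ → ℝ := fun u => ∫ t in (0:ℝ)..(Real.exp u), z t with hNdef
  have hNc : Continuous N :=
    (intervalIntegral.continuous_primitive (fun a b => hzc.intervalIntegrable a b) 0).comp Real.continuous_exp
  have hN0 : ∀ u, 0 ≤ N u := fun u => intervalIntegral.integral_nonneg (Real.exp_pos u).le fun t _ => hz0 t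
  have hN : Monotone N := by
    intro a b hab
    have : N b - N a = ∫ t in (Real.exp a)..(Real.exp b), z t :=
      intervalIntegral.integral_interval_sub_left (hzc.intervalIntegrable _ _) (hzc.intervalIntegrable _ _)
    have h2 : 0 ≤ ∫ t in (Real.exp a)..(Real.exp b), z t :=
      intervalIntegral.integral_nonneg (Real.exp_le_exp.2 hab) fun t _ => hz0 t
    linarith
  set e : ℝ → ℝ := fun u => E2 (Real.exp u) with hedef
  have he : ∀ u, e u = N u - Real.exp u * P4.eval u := by
    intro u
    simp only [hedef, hE2, Real.log_exp, hNdef, hz]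
  have hec : Continuous e := by
    have : e = fun u => N u - Real.exp u * P4.eval u := funext he
    rw [this]
    have := P4.continuous
    fun_prop
  set β : ℝ := 2/3 + δ with hβ
  set γ : ℝ := 1 + δ with hγ
  obtain ⟨C1, hC1, hpt1⟩ := hpt δ hδ
  obtain ⟨C2, hC2, hbd2⟩ := aux_bdd e hec (Real.log 2)
  have heA : ∀ u, 0 ≤ u → |e u| ≤ (C1 + C2) * Real.exp (β * u) := by
    intro u hu
    have hx : 1 ≤ Real.exp (β * u) := Real.one_le_exp (by positivity)
    by_cases hc : u ≤ Real.log 2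
    · have := hbd2 u hu hc
      nlinarith
    · have h2 : 2 ≤ Real.exp u := by
        rw [← Real.exp_log (show (0:ℝ) < 2 by norm_num)]
        exact Real.exp_le_exp.2 (not_le.1 hc).le
      have := hpt1 _ h2
      rw [← Real.exp_mul, mul_comm u] at this
      have h3 : |e u| ≤ C1 * Real.exp (β * u) := this
      nlinarith
  obtain ⟨C3, hC3, hp3⟩ := aux_poly P4 δ hδ
  have hNB : ∀ u, 0 ≤ u → N u ≤ (C1 + C2 + C3) * Real.exp (γ * u) := by
    intro u hu
    have h1 := (abs_le.1 (heA u hu)).2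
    have h2 := (abs_le.1 (hp3 u hu)).2
    have h3 : Real.exp (β * u) ≤ Real.exp (γ * u) := by
      apply Real.exp_le_exp.2
      rw [hβ, hγ]; nlinarith
    have h4 : Real.exp u * Real.exp (δ * u) = Real.exp (γ * u) := by
      rw [← Real.exp_add, hγ]; ring_nf
    have h5 : Real.exp u * P4.eval u ≤ Real.exp u * (C3 * Real.exp (δ * u)) := by gcongr
    have h6 : Real.exp u * (C3 * Real.exp (δ * u)) = C3 * Real.exp (γ * u) := by rw [← h4]; ring
    have h7 : (C1 + C2) * Real.exp (β * u) ≤ (C1 + C2) * Real.exp (γ * u) := by gcongr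
    have := he u
    linarith
  obtain ⟨D, hD, hDb⟩ := aux_poly_diff P4 δ hδ
  have hd : ∀ h u, 0 < h → h ≤ 1 → 0 ≤ u →
      |e (u + h) - e u| ≤ N (u + h) - N u + h * (D * Real.exp (γ * u)) := by
    intro h u hh hh1 hu
    have h1 := hDb h u hh hh1 hu
    have h2 : N u ≤ N (u + h) := hN (by linarith)
    rw [he, he, show N (u + h) - Real.exp (u + h) * P4.eval (u + h) - (N u - Real.exp u * P4.eval u) =
      (N (u + h) - N u) - (Real.exp (u + h) * P4.eval (u + h) - Real.exp u * P4.eval u) by ring]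
    refine (abs_sub _ _).trans ?_
    rw [abs_of_nonneg (sub_nonneg.2 h2)]
    linarith
  obtain ⟨C, hC, hcore⟩ := aux_core e N σ β γ (C1 + C2) (C1 + C2 + C3) D hec hN hN0
    (by positivity) (by positivity) (by positivity) hD (by linarith) heA hNB hd (by linarith)
  refine ⟨(E2 1) ^ 4 + 800 * C * (σ + 1) + 1, by positivity, fun T hT => ?_⟩
  set h : ℝ := 1 / (2 * (σ + T)) with hh
  have hσT : 0 < σ + T := by linarith
  have hh0 : 0 < h := by positivity
  have hh1 : h ≤ 1 := by
    rw [hh, div_le_one (by positivity)]; linarith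
  obtain ⟨hg2, hg3⟩ := hcore h hh0 hh1
  obtain ⟨hg1, htr⟩ := aux_transfer e σ β (C1 + C2) hec heA (by linarith) h
  obtain ⟨hbes, hcont⟩ := aux_bessel _ hg1 hg2 T (by linarith)
  set G : ℝ → ℂ := fun t => ∫ u : ℝ, ((((Set.Ioi (0:ℝ)).indicator (fun u => e u ^ 2) (u + h)
        - (Set.Ioi (0:ℝ)).indicator (fun u => e u ^ 2) u) * Real.exp (-σ * u) : ℝ) : ℂ) *
          cexp (-(I * t * u)) with hG
  have hpw : ∀ t ∈ Set.Ioc 1 T, ‖K (σ + Complex.I * t)‖ ^ 2 ≤ (E2 1) ^ 4 + 4 / h ^ 2 * ‖G t‖ ^ 2 := by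
    intro t ht
    set s : ℂ := σ + I * t with hs
    have hGt : G t = _ := htr t
    have hKs := hK s (by simp [hs]; linarith)
    rw [aux_cov] at hKs
    set F : ℂ := ∫ u in Set.Ioi (0:ℝ), (((E2 (Real.exp u)) ^ 2 : ℝ) : ℂ) * cexp (-s * u) with hF
    have hGt' : G t = (cexp (s * h) - 1) * F := hGt
    have hsn : ‖s‖ ≤ σ + T := by
      refine (norm_add_le _ _).trans ?_
      rw [norm_mul, norm_I, one_mul, norm_real, norm_real, Real.norm_of_nonneg (by linarith),
        Real.norm_of_nonneg (by linarith [ht.1])]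
      linarith [ht.2]
    have hshn : ‖s * (h : ℂ)‖ = ‖s‖ * h := by rw [norm_mul, norm_real, Real.norm_of_nonneg hh0.le]
    have hsh : ‖s * (h : ℂ)‖ ≤ 1/2 := by
      rw [hshn]
      calc ‖s‖ * h ≤ (σ + T) * h := by gcongr
        _ = 1/2 := by rw [hh]; field_simp
    have h1 := Complex.norm_exp_sub_one_sub_id_le (x := s * (h : ℂ)) (by linarith)
    have h2 : ‖s‖ * h / 2 ≤ ‖cexp (s * h) - 1‖ := by
      have h3 := norm_sub_norm_le (s * (h : ℂ)) (s * (h : ℂ) - (cexp (s * h) - 1))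
      rw [sub_sub_cancel] at h3
      rw [norm_sub_rev] at h1
      rw [← hshn]
      nlinarith [norm_nonneg (s * (h : ℂ))]
    have h4 : ‖s * F‖ ≤ 2 / h * ‖G t‖ := by
      rw [hGt', norm_mul, norm_mul, div_mul_eq_mul_div, le_div_iff₀ hh0]
      nlinarith [norm_nonneg F]
    have h5 : ‖K s‖ ≤ 1/2 * (E2 1) ^ 2 + 1/2 * ‖s * F‖ := by
      rw [hKs]
      refine (norm_sub_le _ _).trans (le_of_eq ?_)
      rw [mul_assoc, norm_mul, norm_mul _ (s * F), norm_pow, norm_real, Real.norm_eq_abs, sq_abs]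
      norm_num
    have h6 : ‖K s‖ ≤ 1/2 * (E2 1) ^ 2 + 1/2 * (2 / h * ‖G t‖) := by linarith
    calc ‖K s‖ ^ 2 ≤ (1/2 * (E2 1) ^ 2 + 1/2 * (2 / h * ‖G t‖)) ^ 2 := by gcongr
      _ ≤ (E2 1 ^ 2) ^ 2 + (2 / h * ‖G t‖) ^ 2 := by
        nlinarith [sq_nonneg (E2 1 ^ 2 - 2 / h * ‖G t‖), sq_nonneg (E2 1 ^ 2), sq_nonneg (2 / h * ‖G t‖)]
      _ = _ := by ring
  have hT1 : (1:ℝ) ≤ T := by linarith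
  have hGi : IntervalIntegrable (fun t => ‖G t‖ ^ 2) volume 1 T :=
    (by fun_prop : Continuous fun t => ‖G t‖ ^ 2).intervalIntegrable _ _
  have hRi : IntervalIntegrable (fun t => (E2 1) ^ 4 + 4 / h ^ 2 * ‖G t‖ ^ 2) volume 1 T :=
    (by fun_prop : Continuous fun t => (E2 1) ^ 4 + 4 / h ^ 2 * ‖G t‖ ^ 2).intervalIntegrable _ _
  have hmono : (∫ t in (1:ℝ)..T, ‖K (σ + Complex.I * t)‖ ^ 2) ≤
      ∫ t in (1:ℝ)..T, ((E2 1) ^ 4 + 4 / h ^ 2 * ‖G t‖ ^ 2) := by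
    rw [intervalIntegral.integral_of_le hT1, intervalIntegral.integral_of_le hT1]
    refine integral_mono_of_nonneg (Filter.Eventually.of_forall fun t => by
      simp only [Pi.zero_apply]; positivity) ((intervalIntegrable_iff_integrableOn_Ioc_of_le hT1).1 hRi) ?_
    exact (ae_restrict_iff' measurableSet_Ioc).2 (Filter.Eventually.of_forall hpw)
  refine hmono.trans ?_
  rw [intervalIntegral.integral_add (by simp) (hGi.const_mul _), intervalIntegral.integral_const,
    intervalIntegral.integral_const_mul, smul_eq_mul]
  have hfin : 4 / h ^ 2 * ∫ t in (1:ℝ)..T, ‖G t‖ ^ 2 ≤ 800 * C * (σ + T) := by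
    calc _ ≤ 4 / h ^ 2 * (100 * (C * h)) := by
          gcongr
          exact hbes.trans (by linarith)
      _ = 400 * C / h := by field_simp; ring
      _ = _ := by rw [hh]; field_simp; ring
  have hTT : T ≤ T ^ (1 + ε) := Real.self_le_rpow_of_one_le hT1 (by linarith)
  have hE4 : 0 ≤ E2 1 ^ 4 := by positivity
  have hCσ : 0 ≤ C * σ := mul_nonneg hC (by linarith)
  calc (T - 1) * E2 1 ^ 4 + 4 / h ^ 2 * ∫ t in (1:ℝ)..T, ‖G t‖ ^ 2
      ≤ (E2 1 ^ 4 + 800 * C * (σ + 1) + 1) * T := by nlinarith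
    _ ≤ _ := by
      have : 0 ≤ E2 1 ^ 4 + 800 * C * (σ + 1) + 1 := by nlinarith
      gcongr
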